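/- Let f : ℝⁿ → [0,∞) be a function all of whose superlevel sets {x : f(x) > s}, s > 0, are open and convex. Write ℝⁿ = ℝᵏ × ℝ^{n−k}, and for x' ∈ ℝᵏ let ρ(x', s) be the radius of the ball in ℝ^{n−k} whose volume equals |{v ∈ ℝ^{n−k} : f(x', v) > s}| (assumed finite). Then for every s > 0, the function x' ↦ ρ(x', s) is concave on the set {x' : ρ(x', s) ≠ 0}, and hence continuous on the interior of that set. -/

import Mathlib

open MeasureTheory Set
open scoped ENNReal

/-- The one-dimensional Brunn–Minkowski inequality for compact sets. -/
theorem volume_add_volume_le_of_isCompact {K L C : Set ℝ} (hK : IsCompact K) (hL : IsCompact L)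
    (hK₀ : K.Nonempty) (hL₀ : L.Nonempty) (hC : ∀ x ∈ K, ∀ y ∈ L, x + y ∈ C) :
    volume K + volume L ≤ volume C := by
  have hKL : AEDisjoint volume ((fun x => x + sInf L) '' K) ((fun y => sSup K + y) '' L) := by
    refine measure_mono_null (t := {sSup K + sInf L}) ?_ (by simp)
    rintro _ ⟨⟨x, hx, rfl⟩, ⟨y, hy, hxy⟩⟩
    have h₁ := le_csSup hK.bddAbove hx
    have h₂ := csInf_le hL.bddBelow hy
    simp only [mem_singleton_iff] at hxy ⊢
    linarith
  have hL' : MeasurableSet ((fun y => sSup K + y) '' L) :=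
    (hL.image (by fun_prop)).measurableSet
  calc volume K + volume L
      = volume ((fun x => x + sInf L) '' K) + volume ((fun y => sSup K + y) '' L) := by simp
    _ = volume ((fun x => x + sInf L) '' K ∪ (fun y => sSup K + y) '' L) :=
      (measure_union₀ hL'.nullMeasurableSet hKL).symm
    _ ≤ volume C := by
      refine measure_mono (union_subset ?_ ?_)
      · rintro _ ⟨x, hx, rfl⟩
        exact hC x hx _ (hL.sInf_mem hL₀)
      · rintro _ ⟨y, hy, rfl⟩
        exact hC _ (hK.sSup_mem hK₀) y hy

/-- The one-dimensional Brunn–Minkowski inequality for measurable sets. -/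
theorem volume_add_volume_le {A B C : Set ℝ} (hA : MeasurableSet A) (hB : MeasurableSet B)
    (hA₀ : A.Nonempty) (hB₀ : B.Nonempty) (hC : ∀ x ∈ A, ∀ y ∈ B, x + y ∈ C) :
    volume A + volume B ≤ volume C := by
  obtain ⟨p, hp⟩ := hA₀
  obtain ⟨q, hq⟩ := hB₀
  rw [hA.measure_eq_iSup_isCompact, hB.measure_eq_iSup_isCompact]
  simp only [iSup_and']
  refine ENNReal.biSup_add_biSup_le' ⟨∅, by simp⟩ ⟨∅, by simp⟩ ?_
  rintro K ⟨hKA, hK⟩ L ⟨hLB, hL⟩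
  calc volume K + volume L ≤ volume (insert p K) + volume (insert q L) := by
        gcongr <;> exact subset_insert _ _
    _ ≤ volume C :=
      volume_add_volume_le_of_isCompact (hK.insert p) (hL.insert q) (insert_nonempty _ _)
        (insert_nonempty _ _) fun x hx y hy =>
          hC x (insert_subset hp hKA hx) y (insert_subset hq hLB hy)

/-- The layer cake formula for finite `ℝ≥0∞`-valued functions. -/
theorem lintegral_eq_lintegral_meas_ofReal_lt {α : Type*} [MeasurableSpace α] (μ : Measure α)
    {f : α → ℝ≥0∞} (hf : Measurable f) (hf_top : ∀ x, f x ≠ ⊤) :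
    ∫⁻ x, f x ∂μ = ∫⁻ t in Ioi (0 : ℝ), μ {x | ENNReal.ofReal t < f x} := by
  have h := lintegral_eq_lintegral_meas_lt μ (f := fun x => (f x).toReal)
    (Filter.Eventually.of_forall fun _ => ENNReal.toReal_nonneg) hf.ennreal_toReal.aemeasurable
  simp only [ENNReal.ofReal_toReal (hf_top _)] at h
  rw [h]
  refine setLIntegral_congr_fun measurableSet_Ioi fun t ht => ?_
  simp only [ENNReal.ofReal_lt_iff_lt_toReal (le_of_lt ht) (hf_top _)]

/-- Weighted AM-GM inequality for two extended nonnegative reals. -/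
theorem ENNReal.rpow_mul_rpow_le_weighted_add {a b : ℝ} (ha : 0 < a) (hb : 0 < b)
    (hab : a + b = 1) (p q : ℝ≥0∞) :
    p ^ a * q ^ b ≤ ENNReal.ofReal a * p + ENNReal.ofReal b * q := by
  have h := ENNReal.young_inequality (p ^ a) (q ^ b)
    (Real.HolderConjugate.inv_inv ha hb hab)
  rw [← ENNReal.rpow_mul, ← ENNReal.rpow_mul, mul_inv_cancel₀ ha.ne', mul_inv_cancel₀ hb.ne',
    ENNReal.rpow_one, ENNReal.rpow_one, ENNReal.ofReal_inv_of_pos ha,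
    ENNReal.ofReal_inv_of_pos hb, div_eq_mul_inv, div_eq_mul_inv, inv_inv, inv_inv,
    mul_comm p, mul_comm q] at h
  exact h

open scoped Pointwise in
/-- The one-dimensional Prékopa–Leindler inequality for functions with supremum `1`. -/
theorem prekopa_leindler_real_of_iSup_eq_one {a b : ℝ} (ha : 0 < a) (hb : 0 < b)
    (hab : a + b = 1) {f g h : ℝ → ℝ≥0∞} (hf : Measurable f) (hg : Measurable g)
    (hh : Measurable h) (hf₁ : ⨆ x, f x = 1) (hg₁ : ⨆ x, g x = 1)
    (hfgh : ∀ x y, f x ^ a * g y ^ b ≤ h (a * x + b * y)) :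
    (∫⁻ x, f x) ^ a * (∫⁻ x, g x) ^ b ≤ ∫⁻ x, h x := by
  have hf_le x : f x ≤ 1 := hf₁ ▸ le_iSup f x
  have hg_le x : g x ≤ 1 := hg₁ ▸ le_iSup g x
  refine (ENNReal.rpow_mul_rpow_le_weighted_add ha hb hab _ _).trans ?_
  refine le_trans ?_ (lintegral_mono fun x => min_le_left (h x) 1)
  have meas_f : Measurable fun t : ℝ => volume {x | ENNReal.ofReal t < f x} :=
    Antitone.measurable fun s t hst => measure_mono fun x hx =>
      (ENNReal.ofReal_le_ofReal hst).trans_lt hx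
  rw [lintegral_eq_lintegral_meas_ofReal_lt volume hf fun x => ((hf_le x).trans_lt (by simp)).ne,
    lintegral_eq_lintegral_meas_ofReal_lt volume hg fun x => ((hg_le x).trans_lt (by simp)).ne,
    lintegral_eq_lintegral_meas_ofReal_lt volume (hh.min measurable_const)
      fun x => ((min_le_right _ _).trans_lt (by simp)).ne,
    ← lintegral_const_mul' _ _ (by simp), ← lintegral_const_mul' _ _ (by simp),
    ← lintegral_add_left (meas_f.const_mul _)]
  refine setLIntegral_mono' measurableSet_Ioi fun t ht => ?_
  obtain ht₁ | ht₁ := le_or_gt 1 (ENNReal.ofReal t)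
  · have hf_empty : {x | ENNReal.ofReal t < f x} = ∅ :=
      eq_empty_of_forall_notMem fun x hx => (((hf_le x).trans ht₁).trans_lt hx).false
    have hg_empty : {x | ENNReal.ofReal t < g x} = ∅ :=
      eq_empty_of_forall_notMem fun x hx => (((hg_le x).trans ht₁).trans_lt hx).false
    simp [hf_empty, hg_empty]
  have hvol {c : ℝ} (hc : 0 < c) (S : Set ℝ) : ENNReal.ofReal c * volume S = volume (c • S) := by
    rw [Measure.addHaar_smul]
    simp [abs_of_pos hc]
  rw [hvol ha, hvol hb]
  refine volume_add_volume_le ((hf measurableSet_Ioi).const_smul_of_ne_zero ha.ne')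
    ((hg measurableSet_Ioi).const_smul_of_ne_zero hb.ne') ?_ ?_ ?_
  · rw [← hf₁] at ht₁
    exact Set.Nonempty.smul_set (lt_iSup_iff.1 ht₁)
  · rw [← hg₁] at ht₁
    exact Set.Nonempty.smul_set (lt_iSup_iff.1 ht₁)
  · rintro _ ⟨x, hx, rfl⟩ _ ⟨y, hy, rfl⟩
    refine lt_min (lt_of_lt_of_le ?_ (hfgh x y)) ht₁
    have ht₀ : ENNReal.ofReal t ≠ 0 := by simpa using ht
    calc ENNReal.ofReal t = ENNReal.ofReal t ^ a * ENNReal.ofReal t ^ b := by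
          rw [← ENNReal.rpow_add _ _ ht₀ (by simp), hab, ENNReal.rpow_one]
      _ < f x ^ a * g y ^ b :=
        ENNReal.mul_lt_mul (ENNReal.rpow_lt_rpow hx ha) (ENNReal.rpow_lt_rpow hy hb)

/-- The one-dimensional Prékopa–Leindler inequality for bounded functions. -/
theorem prekopa_leindler_real_of_iSup_ne_top {a b : ℝ} (ha : 0 < a) (hb : 0 < b)
    (hab : a + b = 1) {f g h : ℝ → ℝ≥0∞} (hf : Measurable f) (hg : Measurable g)
    (hh : Measurable h) (hf_top : ⨆ x, f x ≠ ⊤) (hg_top : ⨆ x, g x ≠ ⊤)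
    (hfgh : ∀ x y, f x ^ a * g y ^ b ≤ h (a * x + b * y)) :
    (∫⁻ x, f x) ^ a * (∫⁻ x, g x) ^ b ≤ ∫⁻ x, h x := by
  set M := ⨆ x, f x with hM
  set N := ⨆ x, g x with hN
  by_cases hM₀ : M = 0
  · have hf₀ : ∀ x, f x = 0 := by simpa [hM] using hM₀
    simp [hf₀, ha]
  by_cases hN₀ : N = 0
  · have hg₀ : ∀ x, g x = 0 := by simpa [hN] using hN₀
    simp [hg₀, hb]
  have key := prekopa_leindler_real_of_iSup_eq_one ha hb hab (hf.const_mul M⁻¹)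
    (hg.const_mul N⁻¹) (hh.const_mul ((M⁻¹) ^ a * (N⁻¹) ^ b))
    (by rw [← ENNReal.mul_iSup, ENNReal.inv_mul_cancel hM₀ hf_top])
    (by rw [← ENNReal.mul_iSup, ENNReal.inv_mul_cancel hN₀ hg_top])
    (fun x y => by
      rw [ENNReal.mul_rpow_of_nonneg _ _ ha.le, ENNReal.mul_rpow_of_nonneg _ _ hb.le,
        mul_mul_mul_comm]
      gcongr
      exact hfgh x y)
  rw [lintegral_const_mul _ hf, lintegral_const_mul _ hg, lintegral_const_mul _ hh,
    ENNReal.mul_rpow_of_nonneg _ _ ha.le, ENNReal.mul_rpow_of_nonneg _ _ hb.le,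
    mul_mul_mul_comm] at key
  refine (ENNReal.mul_le_mul_iff_right ?_ ?_).1 key
  · simp [ha.le, hb.le, hf_top, hg_top, ha, hb]
  · finiteness

/-- The one-dimensional Prékopa–Leindler inequality. -/
theorem prekopa_leindler_real {a b : ℝ} (ha : 0 < a) (hb : 0 < b) (hab : a + b = 1)
    {f g h : ℝ → ℝ≥0∞} (hf : Measurable f) (hg : Measurable g) (hh : Measurable h)
    (hfgh : ∀ x y, f x ^ a * g y ^ b ≤ h (a * x + b * y)) :
    (∫⁻ x, f x) ^ a * (∫⁻ x, g x) ^ b ≤ ∫⁻ x, h x := by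
  by_cases hf₀ : ∫⁻ x, f x = 0
  · simp [hf₀, ha]
  by_cases hg₀ : ∫⁻ x, g x = 0
  · simp [hg₀, hb]
  have lim {u : ℝ → ℝ≥0∞} (hu : Measurable u) {c : ℝ} :
      Filter.Tendsto (fun n : ℕ => (∫⁻ x, min (u x) n) ^ c) Filter.atTop
        (nhds ((∫⁻ x, u x) ^ c)) := by
    refine (ENNReal.continuous_rpow_const.tendsto _).comp
      (lintegral_tendsto_of_tendsto_of_monotone
        (fun n => (hu.min measurable_const).aemeasurable)
        (Filter.Eventually.of_forall fun x m n hmn => min_le_min_left _ (by exact_mod_cast hmn))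
        (Filter.Eventually.of_forall fun x => ?_))
    simpa using (tendsto_const_nhds (x := u x)).min ENNReal.tendsto_nat_nhds_top
  refine le_of_tendsto' (ENNReal.Tendsto.mul (lim hf) (Or.inl ?_) (lim hg) (Or.inl ?_)) fun n => ?_
  · simp [hf₀, ha, not_lt_of_gt ha]
  · simp [hg₀, hb, not_lt_of_gt hb]
  have bdd (u : ℝ → ℝ≥0∞) : ⨆ x, min (u x) n ≠ ⊤ :=
    ((iSup_le fun x => min_le_right (u x) n).trans_lt (by simp)).ne
  refine prekopa_leindler_real_of_iSup_ne_top ha hb hab (hf.min measurable_const)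
    (hg.min measurable_const) hh (bdd f) (bdd g) fun x y => le_trans ?_ (hfgh x y)
  gcongr <;> exact min_le_left _ _

/-- The Prékopa–Leindler inequality. -/
theorem prekopa_leindler {a b : ℝ} (ha : 0 < a) (hb : 0 < b) (hab : a + b = 1) {m : ℕ}
    {f g h : (Fin m → ℝ) → ℝ≥0∞} (hf : Measurable f) (hg : Measurable g) (hh : Measurable h)
    (hfgh : ∀ x y, f x ^ a * g y ^ b ≤ h (a • x + b • y)) :
    (∫⁻ x, f x) ^ a * (∫⁻ x, g x) ^ b ≤ ∫⁻ x, h x := by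
  induction m with
  | zero =>
    have lintegral_eq (u : (Fin 0 → ℝ) → ℝ≥0∞) : ∫⁻ x, u x = u 0 := by
      rw [lintegral_unique, volume_pi, Measure.pi_of_empty, measure_univ, mul_one]
      exact congrArg u (Subsingleton.elim _ _)
    simpa [lintegral_eq] using hfgh 0 0
  | succ m ih =>
    let e := (MeasurableEquiv.piFinSuccAbove (fun _ : Fin (m + 1) => ℝ) 0).symm
    have he_meas : Measurable e := e.measurable
    have he (x y : ℝ) (v w : Fin m → ℝ) :
        a • e (x, v) + b • e (y, w) = e (a * x + b * y, a • v + b • w) := by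
      ext i
      refine Fin.cases ?_ (fun j => ?_) i <;> simp [e]
    have fubini {u : (Fin (m + 1) → ℝ) → ℝ≥0∞} (hu : Measurable u) :
        ∫⁻ x, u x = ∫⁻ x : ℝ, ∫⁻ v : Fin m → ℝ, u (e (x, v)) := by
      rw [← ((volume_preserving_piFinSuccAbove (fun _ : Fin (m + 1) => ℝ) 0).symm _).lintegral_comp
        hu, Measure.volume_eq_prod]
      exact lintegral_prod _ (hu.comp he_meas).aemeasurable
    have meas {u : (Fin (m + 1) → ℝ) → ℝ≥0∞} (hu : Measurable u) :
        Measurable fun x : ℝ => ∫⁻ v : Fin m → ℝ, u (e (x, v)) :=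
      (hu.comp he_meas).lintegral_prod_right'
    have meas_slice {u : (Fin (m + 1) → ℝ) → ℝ≥0∞} (hu : Measurable u) (x : ℝ) :
        Measurable fun v : Fin m → ℝ => u (e (x, v)) :=
      (hu.comp he_meas).comp measurable_prodMk_left
    rw [fubini hf, fubini hg, fubini hh]
    refine prekopa_leindler_real ha hb hab (meas hf) (meas hg) (meas hh) fun x y => ?_
    refine ih (meas_slice hf x) (meas_slice hg y) (meas_slice hh _) fun v w => ?_
    rw [← he]
    exact hfgh _ _

/-- The multiplicative Brunn–Minkowski inequality in Euclidean space. -/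
theorem volume_rpow_mul_volume_rpow_le {a b : ℝ} (ha : 0 < a) (hb : 0 < b) (hab : a + b = 1)
    {m : ℕ} {A B C : Set (EuclideanSpace ℝ (Fin m))} (hA : MeasurableSet A)
    (hB : MeasurableSet B) (hC : MeasurableSet C)
    (hABC : ∀ x ∈ A, ∀ y ∈ B, a • x + b • y ∈ C) :
    volume A ^ a * volume B ^ b ≤ volume C := by
  have hvol {S : Set (EuclideanSpace ℝ (Fin m))} (hS : MeasurableSet S) :
      volume S = ∫⁻ x : Fin m → ℝ, S.indicator 1 (WithLp.toLp 2 x) := by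
    rw [(PiLp.volume_preserving_toLp (Fin m)).lintegral_comp (measurable_one.indicator hS),
      lintegral_indicator_one hS]
  have meas {S : Set (EuclideanSpace ℝ (Fin m))} (hS : MeasurableSet S) :
      Measurable fun x : Fin m → ℝ => S.indicator (1 : EuclideanSpace ℝ (Fin m) → ℝ≥0∞) (WithLp.toLp 2 x) :=
    (measurable_one.indicator hS).comp (PiLp.volume_preserving_toLp (Fin m)).measurable
  rw [hvol hA, hvol hB, hvol hC]
  refine prekopa_leindler ha hb hab (meas hA) (meas hB) (meas hC) fun x y => ?_
  by_cases hx : WithLp.toLp 2 x ∈ A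
  · by_cases hy : WithLp.toLp 2 y ∈ B
    · have hxy := hABC _ hx _ hy
      simp [hx, hy, hxy]
    · simp [hy, hb]
  · simp [hx, ha]

open scoped Pointwise in
/-- The Brunn–Minkowski inequality, in terms of the radii of balls of the same volume. -/
theorem radius_add_radius_le {m : ℕ} (hm : 1 ≤ m) {a b : ℝ} (ha : 0 < a) (hb : 0 < b)
    {A B C : Set (EuclideanSpace ℝ (Fin m))} (hA : MeasurableSet A)
    (hB : MeasurableSet B) (hC : MeasurableSet C)
    (hABC : ∀ x ∈ A, ∀ y ∈ B, a • x + b • y ∈ C) {p q r : ℝ} (hp : 0 < p) (hq : 0 < q)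
    (hr : 0 ≤ r)
    (hpA : volume (Metric.ball (0 : EuclideanSpace ℝ (Fin m)) p) = volume A)
    (hqB : volume (Metric.ball (0 : EuclideanSpace ℝ (Fin m)) q) = volume B)
    (hrC : volume (Metric.ball (0 : EuclideanSpace ℝ (Fin m)) r) = volume C) :
    a * p + b * q ≤ r := by
  have : Nonempty (Fin m) := ⟨⟨0, hm⟩⟩
  set κ := volume (Metric.ball (0 : EuclideanSpace ℝ (Fin m)) 1) with hκ
  have hκ₀ : κ ≠ 0 := (Metric.measure_ball_pos _ _ one_pos).ne'
  have hκ_top : κ ≠ ⊤ := measure_ball_lt_top.ne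
  set S := a * p + b * q with hS
  have hS₀ : 0 < S := by positivity
  have hscale {D : Set (EuclideanSpace ℝ (Fin m))} {t d : ℝ} (ht : 0 ≤ t) (hd : 0 < d)
      (hD : volume (Metric.ball (0 : EuclideanSpace ℝ (Fin m)) t) = volume D) :
      volume (d⁻¹ • D) = ENNReal.ofReal ((t / d) ^ m) * κ := by
    rw [Measure.addHaar_smul, ← hD, Measure.addHaar_ball _ _ ht, finrank_euclideanSpace_fin,
      abs_of_pos (by positivity), ← mul_assoc, ← ENNReal.ofReal_mul (by positivity), ← mul_pow,
      inv_mul_eq_div]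
  have key := volume_rpow_mul_volume_rpow_le (a := a * p / S) (b := b * q / S)
    (A := p⁻¹ • A) (B := q⁻¹ • B) (C := S⁻¹ • C) (by positivity) (by positivity)
    (by rw [← add_div, ← hS, div_self hS₀.ne'])
    (hA.const_smul_of_ne_zero (by positivity)) (hB.const_smul_of_ne_zero (by positivity))
    (hC.const_smul_of_ne_zero (by positivity)) (by
      rintro _ ⟨x, hx, rfl⟩ _ ⟨y, hy, rfl⟩
      refine ⟨_, hABC x hx y hy, ?_⟩
      simp only [smul_add, smul_smul]
      congr 2 <;> field_simp)
  rw [hscale hp.le hp hpA, hscale hq.le hq hqB, hscale hr hS₀ hrC, div_self hp.ne',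
    div_self hq.ne', one_pow, ENNReal.ofReal_one, one_mul, ← ENNReal.rpow_add _ _ hκ₀ hκ_top,
    ← add_div, ← hS, div_self hS₀.ne', ENNReal.rpow_one] at key
  by_contra! hrS
  have hlt : (r / S) ^ m < 1 :=
    pow_lt_one₀ (by positivity) ((div_lt_one hS₀).2 hrS) (by omega)
  refine key.not_gt ?_
  calc ENNReal.ofReal ((r / S) ^ m) * κ < 1 * κ :=
        (ENNReal.mul_lt_mul_iff_left hκ₀ hκ_top).2 (by simpa using hlt)
    _ = κ := one_mul κ

/-- If all superlevel sets of `f : ℝᵏ × ℝᵐ → [0,∞)` are open and convex, and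
`ρ x' s` is the radius of the ball in `ℝᵐ` whose volume equals that of the slice
superlevel set `{v : f (x', v) > s}` (assumed finite), then for every `s > 0` the
function `x' ↦ ρ x' s` is concave on `{x' : ρ x' s ≠ 0}` and continuous on the
interior of that set. -/
theorem radius_concave_continuous {k m : ℕ} (hm : 1 ≤ m)
    (f : EuclideanSpace ℝ (Fin k) × EuclideanSpace ℝ (Fin m) → ℝ)
    (hf_nonneg : ∀ x, 0 ≤ f x)
    (hopen : ∀ s : ℝ, 0 < s → IsOpen {x | s < f x})
    (hconv : ∀ s : ℝ, 0 < s → Convex ℝ {x | s < f x})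
    (hfin : ∀ (x' : EuclideanSpace ℝ (Fin k)) (s : ℝ), 0 < s →
      volume {v : EuclideanSpace ℝ (Fin m) | s < f (x', v)} < ⊤)
    (ρ : EuclideanSpace ℝ (Fin k) → ℝ → ℝ)
    (hρ_nonneg : ∀ x' s, 0 ≤ ρ x' s)
    (hρ : ∀ (x' : EuclideanSpace ℝ (Fin k)) (s : ℝ), 0 < s →
      volume (Metric.ball (0 : EuclideanSpace ℝ (Fin m)) (ρ x' s))
        = volume {v : EuclideanSpace ℝ (Fin m) | s < f (x', v)}) :
    ∀ s : ℝ, 0 < s →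
      ConcaveOn ℝ {x' : EuclideanSpace ℝ (Fin k) | ρ x' s ≠ 0} (fun x' => ρ x' s) ∧
      ContinuousOn (fun x' => ρ x' s)
        (interior {x' : EuclideanSpace ℝ (Fin k) | ρ x' s ≠ 0}) := by
  intro s hs
  have meas (x' : EuclideanSpace ℝ (Fin k)) :
      MeasurableSet {v : EuclideanSpace ℝ (Fin m) | s < f (x', v)} :=
    ((hopen s hs).preimage (by fun_prop : Continuous fun v => (x', v))).measurableSet
  have key {x y : EuclideanSpace ℝ (Fin k)} (hx : ρ x s ≠ 0) (hy : ρ y s ≠ 0) {a b : ℝ}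
      (ha : 0 < a) (hb : 0 < b) (hab : a + b = 1) :
      a * ρ x s + b * ρ y s ≤ ρ (a • x + b • y) s :=
    radius_add_radius_le hm ha hb (meas x) (meas y) (meas _)
      (C := {v | s < f (a • x + b • y, v)}) (fun _ hv _ hw => hconv s hs hv hw ha.le hb.le hab)
      ((hρ_nonneg x s).lt_of_ne' hx) ((hρ_nonneg y s).lt_of_ne' hy) (hρ_nonneg _ s)
      (hρ x s hs) (hρ y s hs) (hρ _ s hs)
  have hconcave : ConcaveOn ℝ {x' : EuclideanSpace ℝ (Fin k) | ρ x' s ≠ 0}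
      (fun x' => ρ x' s) := by
    refine concaveOn_iff_forall_pos.2 ⟨convex_iff_forall_pos.2 ?_, ?_⟩
    · intro x hx y hy a b ha hb hab
      have hx₀ := (hρ_nonneg x s).lt_of_ne' hx
      have hy₀ := (hρ_nonneg y s).lt_of_ne' hy
      exact ((by positivity : 0 < a * ρ x s + b * ρ y s).trans_le (key hx hy ha hb hab)).ne'
    · intro x hx y hy a b ha hb hab
      exact key hx hy ha hb hab
  exact ⟨hconcave, hconcave.continuousOn_interior⟩
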